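/- arXiv:0801.4405 — 2 statements merged into one kernel-verified Lean document; each statement's English description precedes it below -/
import Mathlib

section
/- Let m be a positive integer and let A_δ ⊆ ℝ^m, for real δ ≥ 0, be a family of closed sets such that A_δ ⊆ A_{δ'} whenever 0 ≤ δ < δ', and such that ⋂_{δ > 0} A_δ = A_0. For p ∈ A_δ let B_δ(p) denote the set of points reachable by a continuous curve in A_δ starting at p. Let p* ∈ A_0, suppose the set B_0 := B_0(p*) is compact, and suppose there is a constant c > 0 such that every point of A_0 \ B_0 has distance at least c from B_0. Then for every ε > 0 there exists δ > 0 with the following property: for every p ∈ A_δ with ‖p − p*‖ < δ, the set B_δ(p) is contained in the ε-neighborhood of B_0 (i.e., every point of B_δ(p) has distance less than ε from B_0). -/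
/-- The set of points reachable from `p` by a continuous curve `γ : [0,1] → ℝ^m`
whose image is contained in `A` and with `γ 0 = p`. -/
def reachableFrom {m : ℕ} (A : Set (EuclideanSpace ℝ (Fin m)))
    (p : EuclideanSpace ℝ (Fin m)) : Set (EuclideanSpace ℝ (Fin m)) :=
  {q | ∃ γ : Set.Icc (0 : ℝ) 1 → EuclideanSpace ℝ (Fin m),
    Continuous γ ∧ Set.range γ ⊆ A ∧
    γ ⟨0, by norm_num⟩ = p ∧ γ ⟨1, by norm_num⟩ = q}

/-- Lemma 8.2 of Connelly–Demaine–Rote. -/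
theorem stmt_0 (m : ℕ) (hm : 0 < m)
    (A : ℝ → Set (EuclideanSpace ℝ (Fin m)))
    (hclosed : ∀ δ : ℝ, 0 ≤ δ → IsClosed (A δ))
    (hmono : ∀ δ δ' : ℝ, 0 ≤ δ → δ < δ' → A δ ⊆ A δ')
    (hlim : (⋂ δ > (0 : ℝ), A δ) = A 0)
    (pstar : EuclideanSpace ℝ (Fin m)) (hpstar : pstar ∈ A 0)
    (hcompact : IsCompact (reachableFrom (A 0) pstar))
    (c : ℝ) (hc : 0 < c)
    (hsep : ∀ x ∈ A 0 \ reachableFrom (A 0) pstar,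
      c ≤ Metric.infDist x (reachableFrom (A 0) pstar)) :
    ∀ ε > 0, ∃ δ > 0, ∀ p ∈ A δ, ‖p - pstar‖ < δ →
      ∀ q ∈ reachableFrom (A δ) p,
        Metric.infDist q (reachableFrom (A 0) pstar) < ε := by
  intro ε hε
  set B := reachableFrom (A 0) pstar with hB
  have hpB : pstar ∈ B :=
    ⟨fun _ => pstar, continuous_const, by rintro _ ⟨_, rfl⟩; exact hpstar, rfl, rfl⟩
  obtain ⟨r, hr0, hrε, hrc⟩ : ∃ r : ℝ, 0 < r ∧ r < ε ∧ r < c := by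
    obtain ⟨r, h1, h2⟩ := exists_between (lt_min hε hc)
    exact ⟨r, h1, h2.trans_le (min_le_left _ _), h2.trans_le (min_le_right _ _)⟩
  have hcont : Continuous fun x => Metric.infDist x B := Metric.continuous_infDist_pt B
  have hKcl : IsClosed {x | Metric.infDist x B = r} := isClosed_eq hcont continuous_const
  have hKc : IsCompact {x | Metric.infDist x B = r} := by
    refine (hcompact.cthickening (r := r)).of_isClosed_subset hKcl ?_
    intro x hx
    obtain ⟨y, hy, hxy⟩ := hcompact.exists_infDist_eq_dist ⟨pstar, hpB⟩ x
    exact Metric.mem_cthickening_of_dist_le x y r _ hy (hxy.symm.trans hx).le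
  obtain ⟨d, hd0, hd⟩ : ∃ d > 0, ∀ x ∈ A d, Metric.infDist x B ≠ r := by
    by_contra! hcon
    have hpos : ∀ n : ℕ, (0 : ℝ) < 1 / ((n : ℝ) + 1) := fun n => by positivity
    obtain ⟨x, hx⟩ := IsCompact.nonempty_iInter_of_sequence_nonempty_isCompact_isClosed
      (fun n : ℕ => A (1 / ((n : ℝ) + 1)) ∩ {x | Metric.infDist x B = r})
      (by
        intro n
        refine Set.inter_subset_inter_left _ (hmono _ _ (hpos _).le ?_)
        apply one_div_lt_one_div_of_lt
        · positivity
        · push_cast; linarith)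
      (fun n => hcon _ (hpos n))
      (hKc.inter_left (hclosed _ (hpos 0).le))
      (fun n => (hclosed _ (hpos n).le).inter hKcl)
    rw [Set.mem_iInter] at hx
    have hxr : Metric.infDist x B = r := (hx 0).2
    have hxA : x ∈ A 0 := by
      rw [← hlim]
      simp only [Set.mem_iInter]
      intro δ hδ
      obtain ⟨n, hn⟩ := exists_nat_one_div_lt hδ
      exact hmono _ _ (hpos n).le hn (hx n).1
    by_cases hxB : x ∈ B
    · rw [Metric.infDist_zero_of_mem hxB] at hxr
      linarith
    · have := hsep x ⟨hxA, hxB⟩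
      linarith
  refine ⟨min d r, lt_min hd0 hr0, ?_⟩
  rintro p hp hpp q ⟨γ, hγ, hγA, h0, h1⟩
  have hsub : A (min d r) ⊆ A d := by
    rcases (min_le_left d r).eq_or_lt with h | h
    · rw [h]
    · exact hmono _ _ (lt_min hd0 hr0).le h
  refine lt_of_not_ge fun hq => ?_
  have hpr : Metric.infDist p B < r := by
    refine (Metric.infDist_le_dist_of_mem hpB).trans_lt ?_
    rw [dist_eq_norm]
    exact hpp.trans_le (min_le_right _ _)
  have hmem : r ∈ Set.Icc (Metric.infDist (γ ⟨0, by norm_num⟩) B)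
      (Metric.infDist (γ ⟨1, by norm_num⟩) B) := by
    rw [h0, h1]
    exact ⟨hpr.le, hrε.le.trans hq⟩
  obtain ⟨t, ht⟩ := mem_range_of_exists_le_of_exists_ge (hcont.comp hγ) ⟨_, hmem.1⟩ ⟨_, hmem.2⟩
  exact hd _ (hsub (hγA ⟨t, rfl⟩)) ht
end

section
/- Let m be a positive integer and let A_δ ⊆ ℝ^m, for real δ ≥ 0, be a family of closed sets such that A_δ ⊆ A_{δ'} whenever 0 ≤ δ < δ', and such that ⋂_{δ > 0} A_δ = A_0. For p ∈ A_δ let B_δ(p) denote the set of points reachable by a continuous curve in A_δ starting at p. Let p* be an isolated point of A_0 (i.e., p* ∈ A_0 and there exists r > 0 such that A_0 ∩ {x : ‖x − p*‖ < r} = {p*}). Then for every ε > 0 there exists δ > 0 with the following property: for every p ∈ A_δ with ‖p − p*‖ < δ, every point of B_δ(p) has distance less than ε from p*. -/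
/-- Lemma 8.2 of Connelly–Demaine–Rote, in the form applied to an isolated point
of the limit configuration space. -/
theorem stmt_1 (m : ℕ) (hm : 0 < m)
    (A : ℝ → Set (EuclideanSpace ℝ (Fin m)))
    (hclosed : ∀ δ : ℝ, 0 ≤ δ → IsClosed (A δ))
    (hmono : ∀ δ δ' : ℝ, 0 ≤ δ → δ < δ' → A δ ⊆ A δ')
    (hlim : (⋂ δ > (0 : ℝ), A δ) = A 0)
    (pstar : EuclideanSpace ℝ (Fin m)) (hpstar : pstar ∈ A 0)
    (hiso : ∃ r > (0 : ℝ), A 0 ∩ {x | ‖x - pstar‖ < r} = {pstar}) :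
    ∀ ε > 0, ∃ δ > 0, ∀ p ∈ A δ, ‖p - pstar‖ < δ →
      ∀ q ∈ reachableFrom (A δ) p, dist q pstar < ε := by
  intro ε hε
  obtain ⟨r, hr, hA⟩ := hiso
  obtain ⟨s, hs0, hsε, hsr⟩ : ∃ s : ℝ, 0 < s ∧ s ≤ ε ∧ s < r :=
    ⟨min ε (r / 2), lt_min hε (by linarith), min_le_left _ _,
      lt_of_le_of_lt (min_le_right _ _) (by linarith)⟩
  have hle : ∀ a b : ℝ, 0 < a → a ≤ b → A a ⊆ A b := by
    intro a b ha hab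
    rcases hab.lt_or_eq with h | h
    · exact hmono a b ha.le h
    · rw [h]
  have : Nonempty {d : ℝ // 0 < d} := ⟨⟨1, one_pos⟩⟩
  obtain ⟨⟨d, hd⟩, hdS⟩ := (isCompact_sphere pstar s).elim_directed_family_closed
    (fun d : {d : ℝ // 0 < d} => A d.1) (fun d => hclosed d.1 d.2.le)
    (by
      rw [Set.eq_empty_iff_forall_notMem]
      rintro x ⟨hx, hx2⟩
      have hx0 : x ∈ A 0 := by
        rw [← hlim]
        simp only [Set.mem_iInter] at hx2 ⊢
        exact fun d hd => hx2 ⟨d, hd⟩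
      rw [mem_sphere_iff_norm] at hx
      have hx3 : x ∈ A 0 ∩ {x | ‖x - pstar‖ < r} := ⟨hx0, by simpa [hx] using hsr⟩
      rw [hA, Set.mem_singleton_iff] at hx3
      rw [hx3, sub_self, norm_zero] at hx
      exact hs0.ne hx)
    (fun a b => ⟨⟨min a.1 b.1, lt_min a.2 b.2⟩,
      hle _ _ (lt_min a.2 b.2) (min_le_left _ _), hle _ _ (lt_min a.2 b.2) (min_le_right _ _)⟩)
  refine ⟨min d s, lt_min hd hs0, ?_⟩
  rintro p - hp q ⟨γ, hγ, hγA, h0, h1⟩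
  by_contra hq
  have hcont : Continuous fun t => ‖γ t - pstar‖ := by fun_prop
  have hmem := mem_range_of_exists_le_of_exists_ge (c := s) hcont
    ⟨⟨0, by norm_num⟩, by rw [h0]; exact (hp.trans_le (min_le_right _ _)).le⟩
    ⟨⟨1, by norm_num⟩, by rw [h1, ← dist_eq_norm]; linarith⟩
  obtain ⟨t, ht⟩ := hmem
  have : γ t ∈ Metric.sphere pstar s ∩ A d :=
    ⟨mem_sphere_iff_norm.2 ht, hle _ _ (lt_min hd hs0) (min_le_left _ _) (hγA ⟨t, rfl⟩)⟩
  exact (Set.eq_empty_iff_forall_notMem.1 hdS) _ this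
end
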